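/- arXiv:1304.6180 — 2 statements merged into one kernel-verified Lean document; each statement's English description precedes it below -/
import Mathlib

section
/- If u is a positive harmonic function on the upper half plane {Im z > 0} that extends continuously to ℝ with boundary value 0, then u(z) = c·Im z for some constant c ≥ 0. -/
open Complex

/-- The Euclidean Laplacian of `u : ℂ → ℝ` at `z`, computed via iterated partial
derivatives in the real and imaginary directions. -/
noncomputable def laplacian (u : ℂ → ℝ) (z : ℂ) : ℝ :=
  deriv (fun x : ℝ => deriv (fun x' : ℝ => u (x' + z.im * I)) x) z.re +
  deriv (fun y : ℝ => deriv (fun y' : ℝ => u (z.re + y' * I)) y) z.im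

/-- `u` is harmonic on the set `s`: it is `C²` there and its Laplacian vanishes. -/
def HarmonicOn (u : ℂ → ℝ) (s : Set ℂ) : Prop :=
  ContDiffOn ℝ 2 u s ∧ ∀ z ∈ s, laplacian u z = 0

open Filter Topology Metric

lemma aux_harm {u : ℂ → ℝ} (h : HarmonicOn u {z : ℂ | 0 < z.im}) :
    InnerProductSpace.HarmonicOnNhd u {z : ℂ | 0 < z.im} := by
  have hopen : IsOpen {z : ℂ | 0 < z.im} := isOpen_lt continuous_const Complex.continuous_im
  have hC : ∀ z : ℂ, 0 < z.im → ContDiffAt ℝ 2 u z := fun z hz =>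
    (h.1 z hz).contDiffAt (hopen.mem_nhds hz)
  have hD : ∀ z : ℂ, 0 < z.im → HasFDerivAt u (fderiv ℝ u z) z := fun z hz =>
    ((hC z hz).differentiableAt (by norm_num)).hasFDerivAt
  have hD2 : ∀ z : ℂ, 0 < z.im → HasFDerivAt (fderiv ℝ u) (fderiv ℝ (fderiv ℝ u) z) z := fun z hz =>
    (((hC z hz).fderiv_right (m := 1) (by norm_num)).differentiableAt (by norm_num)).hasFDerivAt
  have hx : ∀ z : ℂ, ∀ x : ℝ, HasDerivAt (fun x' : ℝ => ((x' : ℂ) + z.im * I)) 1 x := fun z x =>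
    (Complex.ofRealCLM.hasDerivAt (x := x)).add_const _ |>.congr_deriv (by simp)
  have hy : ∀ z : ℂ, ∀ y : ℝ, HasDerivAt (fun y' : ℝ => ((z.re : ℂ) + y' * I)) I y := fun z y =>
    (((Complex.ofRealCLM.hasDerivAt (x := y)).mul_const I).const_add _).congr_deriv (by simp)
  have key : ∀ z : ℂ, 0 < z.im → Laplacian.laplacian u z = 0 := by
    intro z hz
    have hz' : (z.re : ℂ) + z.im * I = z := Complex.re_add_im z
    have h1 : deriv (fun x : ℝ => deriv (fun x' : ℝ => u (x' + z.im * I)) x) z.re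
        = fderiv ℝ (fderiv ℝ u) z 1 1 := by
      have e : (fun x : ℝ => deriv (fun x' : ℝ => u (x' + z.im * I)) x)
          = fun x : ℝ => fderiv ℝ u (x + z.im * I) 1 := by
        funext x
        exact (HasFDerivAt.comp_hasDerivAt x (hD _ (by simpa using hz)) (hx z x)).deriv
      rw [e]
      have h2 := HasFDerivAt.comp_hasDerivAt z.re (hD2 (z.re + z.im * I) (by simpa using hz)) (hx z z.re)
      have h3 := h2.clm_apply (hasDerivAt_const z.re (1:ℂ))
      rw [hz'] at h3
      simpa using h3.deriv
    have h1' : deriv (fun y : ℝ => deriv (fun y' : ℝ => u (z.re + y' * I)) y) z.im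
        = fderiv ℝ (fderiv ℝ u) z I I := by
      have e : (fun y : ℝ => deriv (fun y' : ℝ => u (z.re + y' * I)) y)
          =ᶠ[𝓝 z.im] fun y : ℝ => fderiv ℝ u (z.re + y * I) I := by
        filter_upwards [lt_mem_nhds hz] with y hy0
        exact (HasFDerivAt.comp_hasDerivAt y (hD _ (by simpa using hy0)) (hy z y)).deriv
      rw [e.deriv_eq]
      have h2 := HasFDerivAt.comp_hasDerivAt z.im (hD2 (z.re + z.im * I) (by simpa using hz)) (hy z z.im)
      have h3 := h2.clm_apply (hasDerivAt_const z.im I)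
      rw [hz'] at h3
      simpa using h3.deriv
    have := h.2 z hz
    rw [laplacian, h1, h1'] at this
    rw [InnerProductSpace.laplacian_eq_iteratedFDeriv_complexPlane]
    simpa [iteratedFDeriv_two_apply] using this
  intro z hz
  exact ⟨hC z hz, by filter_upwards [hopen.mem_nhds hz] with w hw using key w hw⟩

lemma aux_max {K O : Set ℂ} (hK : IsCompact K) (hO : IsOpen O) (hOK : O ⊆ K) {h : ℂ → ℝ}
    (hc : ContinuousOn h K) (hh : InnerProductSpace.HarmonicOnNhd h O) {e : ℝ}
    (hb : ∀ z ∈ K, z ∉ O → h z ≤ e) : ∀ z ∈ K, h z ≤ e := by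
  obtain ⟨B, hB⟩ := hK.isBounded.exists_norm_le
  have main : ∀ d : ℝ, 0 < d → ∀ z ∈ K, h z + d * ‖z‖ ^ 2 ≤ e + d * B ^ 2 := by
    intro d hd z hz
    obtain ⟨c, hcK, hmax⟩ := hK.exists_isMaxOn ⟨z, hz⟩
      (f := fun z => h z + d * ‖z‖ ^ 2) (by fun_prop)
    have hBB : ‖c‖ ^ 2 ≤ B ^ 2 := by gcongr; exact hB c hcK
    by_cases hcO : c ∈ O
    · exfalso
      obtain ⟨r, hr, hrO⟩ := Metric.nhds_basis_closedBall.mem_iff.1 (hO.mem_nhds hcO)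
      set l : ℂ → ℂ := fun z => (2 * d : ℝ) * ((starRingEnd ℂ c) * (z - c)) with hl
      have hlin : Differentiable ℂ l := by fun_prop
      have hk : InnerProductSpace.HarmonicOnNhd (h + fun z => (l z).re) (closedBall c |r|) := by
        rw [abs_of_pos hr]
        exact (hh.mono hrO).add (fun x _ => (hlin.analyticAt x).harmonicAt_re)
      have h1 := hk.circleAverage_eq
      have h2 : Real.circleAverage (h + fun z => (l z).re) c r ≤ h c - d * r ^ 2 := by
        apply Real.circleAverage_mono_on_of_le_circle
        · exact (hk.continuousOn.mono sphere_subset_closedBall).circleIntegrable'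
        · intro x hx
          have hxK : x ∈ K := hOK (hrO (by
            rw [abs_of_pos hr] at hx; exact sphere_subset_closedBall hx))
          have h3 := hmax hxK
          simp only [Set.mem_ofPred_eq] at h3
          have h4 : ‖x‖ ^ 2 = ‖c‖ ^ 2 + r ^ 2 + 2 * ((starRingEnd ℂ c) * (x - c)).re := by
            have : ‖x - c‖ ^ 2 = r ^ 2 := by
              rw [mem_sphere_iff_norm.1 hx, sq_abs]
            rw [← this]
            simp only [← Complex.normSq_eq_norm_sq, Complex.normSq_apply]
            simp
            ring
          have h5 : (l x).re = 2 * d * ((starRingEnd ℂ c) * (x - c)).re := by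
            simp only [hl, Complex.re_ofReal_mul]
          simp only [Pi.add_apply]
          rw [h5]
          rw [h4] at h3
          nlinarith
      rw [h1] at h2
      simp [hl] at h2
      nlinarith [mul_pos hd (pow_pos hr 2)]
    · have h1 := hb c hcK hcO
      have h3 := hmax hz
      simp only [Set.mem_ofPred_eq] at h3
      nlinarith
  intro z hz
  have hlim : Tendsto (fun d : ℝ => e + d * B ^ 2 - d * ‖z‖ ^ 2) (𝓝[>] 0) (𝓝 e) := by
    have : Continuous (fun d : ℝ => e + d * B ^ 2 - d * ‖z‖ ^ 2) := by fun_prop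
    simpa using (this.tendsto 0).mono_left nhdsWithin_le_nhds
  apply ge_of_tendsto hlim
  filter_upwards [self_mem_nhdsWithin] with d hd
  linarith [main d hd z hz]

lemma aux_span {R : ℝ} (hR : 0 < R) (p : C(AddCircle (2 * Real.pi), ℂ))
    (hp : p ∈ Submodule.span ℂ (Set.range (fourier (T := 2 * Real.pi)))) :
    ∃ F G : ℂ → ℂ, Differentiable ℂ F ∧ Differentiable ℂ G ∧
      ∀ x, p x = F (R * fourier 1 x) + starRingEnd ℂ (G (R * fourier 1 x)) := by
  have hR' : (R : ℂ) ≠ 0 := by exact_mod_cast hR.ne'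
  induction hp using Submodule.span_induction with
  | mem f hf =>
    obtain ⟨n, rfl⟩ := hf
    obtain ⟨m, rfl | rfl⟩ := n.eq_nat_or_neg
    · refine ⟨fun z => (z / R) ^ m, 0, by fun_prop, differentiable_const _, fun x => ?_⟩
      simp [hR', fourier_apply, AddCircle.toCircle_nsmul]
    · refine ⟨0, fun z => (z / R) ^ m, differentiable_const _, by fun_prop, fun x => ?_⟩
      simp [hR', fourier_apply, ← Circle.coe_inv_eq_conj, AddCircle.toCircle_nsmul, AddCircle.toCircle_neg]
  | zero => exact ⟨0, 0, differentiable_const _, differentiable_const _, by simp⟩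
  | add p q _ _ ihp ihq =>
    obtain ⟨F, G, hF, hG, h⟩ := ihp
    obtain ⟨F', G', hF', hG', h'⟩ := ihq
    exact ⟨F + F', G + G', hF.add hF', hG.add hG', fun x => by simp [h, h']; ring⟩
  | smul a p _ ih =>
    obtain ⟨F, G, hF, hG, h⟩ := ih
    refine ⟨fun z => a * F z, fun z => starRingEnd ℂ a * G z, by fun_prop, by fun_prop,
      fun x => by simp [h]; ring⟩

lemma aux_approx {R : ℝ} (hR : 0 < R) {U : ℂ → ℝ} (hU : Continuous U) {e : ℝ} (he : 0 < e) :
    ∃ E : ℂ → ℂ, Differentiable ℂ E ∧ ∀ z : ℂ, ‖z‖ = R → |(E z).re - U z| ≤ e := by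
  have : Fact (0 < 2 * Real.pi) := ⟨Real.two_pi_pos⟩
  let g : C(AddCircle (2 * Real.pi), ℂ) := ⟨fun x => (U (R * fourier 1 x) : ℂ), by fun_prop⟩
  have hg : g ∈ (Submodule.span ℂ (Set.range (fourier (T := 2 * Real.pi)))).topologicalClosure := by
    rw [span_fourier_closure_eq_top]; trivial
  obtain ⟨p, hp, hd⟩ := Metric.mem_closure_iff.1 hg e he
  obtain ⟨F, G, hF, hG, h⟩ := aux_span hR p hp
  refine ⟨F + G, hF.add hG, fun z hz => ?_⟩
  set x : AddCircle (2 * Real.pi) := ((z.arg : ℝ) : AddCircle (2 * Real.pi)) with hx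
  have hzx : (R : ℂ) * fourier 1 x = z := by
    rw [hx, fourier_coe_apply, ← hz]
    conv_rhs => rw [← Complex.norm_mul_exp_arg_mul_I z]
    congr 2
    push_cast
    field_simp
  have h1 : ‖g x - p x‖ ≤ e := by
    have := (ContinuousMap.dist_apply_le_dist (f := g) (g := p) x).trans hd.le
    rwa [dist_eq_norm] at this
  have h2 : ((F + G) z).re - U z = -(g x - p x).re := by
    have hgx : g x = (U z : ℂ) := by
      change ((U (R * fourier 1 x) : ℝ) : ℂ) = _
      rw [hzx]
    rw [h x, hzx, hgx]
    simp
  rw [h2, abs_neg]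
  exact (Complex.abs_re_le_norm _).trans h1

/-- Odd reflection of `u` across the real axis. -/
noncomputable def oddExt (u : ℂ → ℝ) (z : ℂ) : ℝ :=
  u ((z.re : ℂ) + (max z.im 0 : ℝ) * I) - u ((z.re : ℂ) + (max (-z.im) 0 : ℝ) * I)

lemma oddExt_cont {u : ℂ → ℝ} (hcont : ContinuousOn u {z : ℂ | 0 ≤ z.im}) :
    Continuous (oddExt u) := by
  unfold oddExt
  refine Continuous.sub (hcont.comp_continuous (by fun_prop) fun z => ?_)
    (hcont.comp_continuous (by fun_prop) fun z => ?_) <;> simp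

lemma oddExt_conj (u : ℂ → ℝ) (z : ℂ) : oddExt u (starRingEnd ℂ z) = - oddExt u z := by
  simp [oddExt]

lemma oddExt_eq {u : ℂ → ℝ} (hbdry : ∀ x : ℝ, u (x : ℂ) = 0) {z : ℂ} (hz : 0 ≤ z.im) :
    oddExt u z = u z := by
  simp [oddExt, hz, hbdry, Complex.re_add_im]

lemma aux_odd_approx {R : ℝ} (hR : 0 < R) {U : ℂ → ℝ} (hU : Continuous U)
    (hodd : ∀ z, U (starRingEnd ℂ z) = - U z) {e : ℝ} (he : 0 < e) :
    ∃ H : ℂ → ℝ, InnerProductSpace.HarmonicOnNhd H Set.univ ∧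
      (∀ z, H (starRingEnd ℂ z) = - H z) ∧ ∀ z : ℂ, ‖z‖ = R → |H z - U z| ≤ e := by
  obtain ⟨E, hE, h⟩ := aux_approx hR hU he
  have hE' : Differentiable ℂ (starRingEnd ℂ ∘ E ∘ starRingEnd ℂ) := fun z => by
    have := (hE (starRingEnd ℂ z)).conj_conj
    simpa using this
  let E2 : ℂ → ℂ := fun z => (1 / 2 : ℂ) * (E z - (starRingEnd ℂ ∘ E ∘ starRingEnd ℂ) z)
  have hE2 : Differentiable ℂ E2 := (hE.sub hE').const_mul _
  have hre : ∀ z, (E2 z).re = 1 / 2 * ((E z).re - (E (starRingEnd ℂ z)).re) := by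
    intro z
    simp [E2]
  refine ⟨fun z => (E2 z).re, fun z _ => (hE2.analyticAt z).harmonicAt_re, fun z => ?_,
    fun z hz => ?_⟩
  · simp only [hre, Complex.conj_conj]; ring
  · have h1 := abs_le.1 (h z hz)
    have h2 := abs_le.1 (h (starRingEnd ℂ z) (by simpa using hz))
    rw [hodd] at h2
    simp only [hre]
    rw [abs_le]
    constructor <;> linarith [h1.1, h1.2, h2.1, h2.2]

lemma pk_cont {R : ℝ} {w : ℂ} (hw : w ∈ ball (0:ℂ) R) :
    ContinuousOn (poissonKernel 0 w) (sphere (0:ℂ) R) := by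
  simp only [funext (poissonKernel_def 0 w)]
  apply ContinuousOn.div (by fun_prop) (by fun_prop)
  intro z hz
  have : z ≠ w := by
    rintro rfl
    simp at hz hw
    linarith
  simpa [sub_eq_zero] using this

lemma pk_nonneg {R : ℝ} {w : ℂ} (hw : w ∈ ball (0:ℂ) R) {z : ℂ} (hz : z ∈ sphere (0:ℂ) R) :
    0 ≤ poissonKernel 0 w z := by
  rw [poissonKernel_def]
  simp at hz hw
  apply div_nonneg _ (by positivity)
  have := norm_nonneg w
  simp [hz]
  nlinarith

lemma aux_poisson {u : ℂ → ℝ}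
    (hharm : HarmonicOn u {z : ℂ | 0 < z.im})
    (hcont : ContinuousOn u {z : ℂ | 0 ≤ z.im})
    (hbdry : ∀ x : ℝ, u (x : ℂ) = 0) {R : ℝ} {w : ℂ} (hw : w ∈ ball (0:ℂ) R) :
    Real.circleAverage (poissonKernel 0 w • oddExt u) 0 R = oddExt u w := by
  have hR : 0 < R := pos_of_mem_ball hw
  have hH := aux_harm hharm
  have hUc := oddExt_cont hcont
  have step : ∀ e : ℝ, 0 < e →
      |Real.circleAverage (poissonKernel 0 w • oddExt u) 0 R - oddExt u w| ≤ 2 * e := by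
    intro e he
    obtain ⟨H, h1, h2, h3⟩ := aux_odd_approx hR hUc (oddExt_conj u) he
    have hHc : Continuous H := continuousOn_univ.1 h1.continuousOn
    have hreal : ∀ z : ℂ, z.im = 0 → H z = 0 := by
      intro z hz
      have h4 := h2 z
      rw [Complex.conj_eq_iff_im.2 hz] at h4
      linarith
    have hureal : ∀ z : ℂ, z.im = 0 → u z = 0 := by
      intro z hz
      have : z = (z.re : ℂ) := by apply Complex.ext <;> simp [hz]
      rw [this]; exact hbdry _
    -- maximum principle on the half disc
    let K : Set ℂ := closedBall 0 R ∩ {z | 0 ≤ z.im}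
    let O : Set ℂ := ball 0 R ∩ {z | 0 < z.im}
    have hK : IsCompact K := (isCompact_closedBall _ _).inter_right
      (isClosed_le continuous_const Complex.continuous_im)
    have hO : IsOpen O := isOpen_ball.inter (isOpen_lt continuous_const Complex.continuous_im)
    have hOK : O ⊆ K := fun z hz => ⟨ball_subset_closedBall hz.1, (show 0 < z.im from hz.2).le⟩
    have hbd : ∀ z ∈ K, z ∉ O → |H z - u z| ≤ e := by
      intro z hz hzO
      have hz2 : 0 ≤ z.im := hz.2
      rcases hz2.eq_or_lt with h0 | h0
      · rw [hreal z h0.symm, hureal z h0.symm]; simpa using he.le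
      · have hn : ‖z‖ = R := by
          have ha : ‖z‖ ≤ R := by simpa using hz.1
          by_contra hne
          exact hzO ⟨by simpa using lt_of_le_of_ne ha hne, h0⟩
        have := h3 z hn
        rwa [oddExt_eq hbdry hz2] at this
    have huK : ContinuousOn u K := hcont.mono fun z hz => hz.2
    have m1 : ∀ z ∈ K, (H - u) z ≤ e := aux_max hK hO hOK (hHc.continuousOn.sub huK)
      ((h1.mono (Set.subset_univ _)).sub (hH.mono fun z hz => hz.2))
      fun z hz hzO => (abs_le.1 (hbd z hz hzO)).2
    have m2 : ∀ z ∈ K, (u - H) z ≤ e := aux_max hK hO hOK (huK.sub hHc.continuousOn)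
      ((hH.mono fun z hz => hz.2).sub (h1.mono (Set.subset_univ _)))
      fun z hz hzO => by
        have := (abs_le.1 (hbd z hz hzO)).1
        simp only [Pi.sub_apply]; linarith
    have m3 : ∀ z ∈ K, |H z - oddExt u z| ≤ e := by
      intro z hz
      rw [oddExt_eq hbdry hz.2, abs_le]
      have a := m1 z hz
      have b := m2 z hz
      simp only [Pi.sub_apply] at a b
      constructor <;> linarith
    have m4 : |H w - oddExt u w| ≤ e := by
      rcases le_total 0 w.im with h0 | h0
      · exact m3 w ⟨ball_subset_closedBall hw, h0⟩
      · have := m3 (starRingEnd ℂ w) ⟨by simpa using (ball_subset_closedBall hw), by simpa using h0⟩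
        rw [h2, oddExt_conj] at this
        rw [← abs_neg]
        convert this using 2
        ring
    have pk := pk_cont hw
    have hP : ∀ a : ℝ, Real.circleAverage (poissonKernel 0 w • (H + fun _ => a)) 0 R = H w + a :=
      fun a => InnerProductSpace.HarmonicOnNhd.circleAverage_poissonKernel_smul
        ((h1.mono (Set.subset_univ _)).add (InnerProductSpace.harmonicOnNhd_const a)) hw
    have hi : ∀ f : ℂ → ℝ, Continuous f → CircleIntegrable (poissonKernel 0 w • f) 0 R :=
      fun f hf => (pk.smul hf.continuousOn).circleIntegrable hR.le
    have i1 : Real.circleAverage (poissonKernel 0 w • oddExt u) 0 R ≤ H w + e := by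
      rw [← hP e]
      apply Real.circleAverage_mono (hi _ hUc) (hi _ (hHc.add continuous_const))
      intro x hx
      rw [abs_of_pos hR] at hx
      apply mul_le_mul_of_nonneg_left _ (pk_nonneg hw hx)
      have := abs_le.1 (h3 x (by simpa using hx))
      simp only [Pi.add_apply]; linarith [this.1]
    have i2 : H w + -e ≤ Real.circleAverage (poissonKernel 0 w • oddExt u) 0 R := by
      rw [← hP (-e)]
      apply Real.circleAverage_mono (hi _ (hHc.add continuous_const)) (hi _ hUc)
      intro x hx
      rw [abs_of_pos hR] at hx
      apply mul_le_mul_of_nonneg_left _ (pk_nonneg hw hx)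
      have := abs_le.1 (h3 x (by simpa using hx))
      simp only [Pi.add_apply]; linarith [this.2]
    rw [abs_le] at m4 ⊢
    constructor <;> linarith [m4.1, m4.2]
  by_contra hne
  have hpos := abs_pos.2 (sub_ne_zero.2 hne)
  have := step _ (by positivity : 0 < |Real.circleAverage (poissonKernel 0 w • oddExt u) 0 R - oddExt u w| / 4)
  linarith

lemma pk_diff {R : ℝ} {w z : ℂ} (hw : w ∈ ball (0:ℂ) R) (hz : z ∈ sphere (0:ℂ) R) :
    poissonKernel 0 w z - poissonKernel 0 (starRingEnd ℂ w) z =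
      4 * w.im * z.im * (R ^ 2 - ‖w‖ ^ 2) / (‖z - w‖ ^ 2 * ‖z - starRingEnd ℂ w‖ ^ 2) := by
  have hz' : ‖z‖ = R := by simpa using hz
  have hw' : ‖w‖ < R := by simpa using hw
  have n1 : ‖z - w‖ ≠ 0 := by
    rw [norm_ne_zero_iff, sub_ne_zero]; rintro rfl; linarith
  have n2 : ‖z - starRingEnd ℂ w‖ ≠ 0 := by
    rw [norm_ne_zero_iff, sub_ne_zero]; rintro rfl
    rw [Complex.norm_conj] at hz'; linarith
  have e : ‖z - starRingEnd ℂ w‖ ^ 2 = ‖z - w‖ ^ 2 + 4 * w.im * z.im := by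
    simp only [← Complex.normSq_eq_norm_sq, Complex.normSq_apply]
    simp
    ring
  rw [poissonKernel_def, poissonKernel_def]
  simp only [sub_zero, Complex.norm_conj, hz']
  field_simp
  rw [e]
  ring

lemma aux_bounds {u : ℂ → ℝ}
    (hharm : HarmonicOn u {z : ℂ | 0 < z.im})
    (hpos : ∀ z : ℂ, 0 < z.im → 0 < u z)
    (hcont : ContinuousOn u {z : ℂ | 0 ≤ z.im})
    (hbdry : ∀ x : ℝ, u (x : ℂ) = 0) {R : ℝ} :
    ∃ A : ℝ, ∀ w : ℂ, ‖w‖ < R → 0 < w.im →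
      4 * w.im * (R ^ 2 - ‖w‖ ^ 2) / (R + ‖w‖) ^ 4 * A ≤ 2 * u w ∧
      2 * u w ≤ 4 * w.im * (R ^ 2 - ‖w‖ ^ 2) / (R - ‖w‖) ^ 4 * A := by
  have hUc := oddExt_cont hcont
  refine ⟨Real.circleAverage (fun z => z.im * oddExt u z) 0 R, fun w hw hwi => ?_⟩
  have hR : 0 < R := (norm_nonneg w).trans_lt hw
  have hwb : w ∈ ball (0:ℂ) R := by simpa using hw
  have hwb' : starRingEnd ℂ w ∈ ball (0:ℂ) R := by simpa using hw
  have hnn : ∀ z : ℂ, 0 ≤ z.im * oddExt u z := by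
    have hp : ∀ z : ℂ, 0 ≤ z.im → 0 ≤ z.im * oddExt u z := by
      intro z hz
      rcases hz.eq_or_lt with h0 | h0
      · simp [← h0]
      · rw [oddExt_eq hbdry hz]; exact (mul_pos h0 (hpos z h0)).le
    intro z
    rcases le_total 0 z.im with h0 | h0
    · exact hp z h0
    · have := hp (starRingEnd ℂ z) (by simpa using h0)
      rw [oddExt_conj] at this
      simpa using this
  have i1 : CircleIntegrable (poissonKernel 0 w • oddExt u) 0 R :=
    ((pk_cont hwb).smul hUc.continuousOn).circleIntegrable hR.le
  have i2 : CircleIntegrable (poissonKernel 0 (starRingEnd ℂ w) • oddExt u) 0 R :=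
    ((pk_cont hwb').smul hUc.continuousOn).circleIntegrable hR.le
  have i3 : ∀ a : ℝ, CircleIntegrable (a • fun z : ℂ => z.im * oddExt u z) 0 R := fun a => by
    apply ContinuousOn.circleIntegrable hR.le
    apply Continuous.continuousOn
    exact (Complex.continuous_im.mul hUc).const_smul a
  have h2u : 2 * u w = Real.circleAverage
      (poissonKernel 0 w • oddExt u - poissonKernel 0 (starRingEnd ℂ w) • oddExt u) 0 R := by
    rw [Real.circleAverage_sub i1 i2, aux_poisson hharm hcont hbdry hwb,
      aux_poisson hharm hcont hbdry hwb', oddExt_conj, oddExt_eq hbdry hwi.le]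
    ring
  have hform : ∀ z ∈ sphere (0:ℂ) |R|,
      (poissonKernel 0 w • oddExt u - poissonKernel 0 (starRingEnd ℂ w) • oddExt u) z =
      4 * w.im * (R ^ 2 - ‖w‖ ^ 2) / (‖z - w‖ ^ 2 * ‖z - starRingEnd ℂ w‖ ^ 2)
        * (z.im * oddExt u z) := by
    intro z hz
    rw [abs_of_pos hR] at hz
    have := pk_diff hwb hz
    change poissonKernel 0 w z * oddExt u z - poissonKernel 0 (starRingEnd ℂ w) z * oddExt u z = _
    rw [← sub_mul, this]
    ring
  have hs : 0 ≤ R ^ 2 - ‖w‖ ^ 2 := by nlinarith [norm_nonneg w]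
  have hRw : 0 < R - ‖w‖ := by linarith
  have hb : ∀ z ∈ sphere (0:ℂ) |R|, ∀ v : ℂ, ‖v‖ = ‖w‖ → R - ‖w‖ ≤ ‖z - v‖ ∧ ‖z - v‖ ≤ R + ‖w‖ := by
    intro z hz v hv
    have hz' : ‖z‖ = R := by rw [abs_of_pos hR] at hz; simpa using hz
    have a := norm_sub_norm_le z v
    have b := norm_sub_le z v
    rw [hv, hz'] at a b
    exact ⟨a, b⟩
  constructor
  · rw [h2u, ← smul_eq_mul, ← Real.circleAverage_smul]
    apply Real.circleAverage_mono (i3 _) (i1.sub i2)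
    intro z hz
    rw [hform z hz]
    apply mul_le_mul_of_nonneg_right _ (hnn z)
    obtain ⟨a, b⟩ := hb z hz w rfl
    obtain ⟨a', b'⟩ := hb z hz _ (Complex.norm_conj w)
    have p1 := hRw.trans_le a
    have p2 := hRw.trans_le a'
    calc _ = 4 * w.im * (R ^ 2 - ‖w‖ ^ 2) / ((R + ‖w‖) ^ 2 * (R + ‖w‖) ^ 2) := by congr 1; ring
      _ ≤ _ := by gcongr
  · rw [h2u, ← smul_eq_mul, ← Real.circleAverage_smul]
    apply Real.circleAverage_mono (i1.sub i2) (i3 _)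
    intro z hz
    rw [hform z hz]
    apply mul_le_mul_of_nonneg_right _ (hnn z)
    obtain ⟨a, b⟩ := hb z hz w rfl
    obtain ⟨a', b'⟩ := hb z hz _ (Complex.norm_conj w)
    calc _ ≤ 4 * w.im * (R ^ 2 - ‖w‖ ^ 2) / ((R - ‖w‖) ^ 2 * (R - ‖w‖) ^ 2) := by gcongr
      _ = _ := by congr 1; ring

lemma aux_ratio {u : ℂ → ℝ}
    (hharm : HarmonicOn u {z : ℂ | 0 < z.im})
    (hpos : ∀ z : ℂ, 0 < z.im → 0 < u z)
    (hcont : ContinuousOn u {z : ℂ | 0 ≤ z.im})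
    (hbdry : ∀ x : ℝ, u (x : ℂ) = 0) {z w : ℂ} (hz : 0 < z.im) (hw : 0 < w.im) :
    u z / z.im ≤ u w / w.im := by
  have hlim : Tendsto (fun R : ℝ => u w / w.im *
      (((1 - (‖z‖ * R⁻¹) ^ 2) * (1 + ‖w‖ * R⁻¹) ^ 4) /
        ((1 - ‖z‖ * R⁻¹) ^ 4 * (1 - (‖w‖ * R⁻¹) ^ 2)))) atTop (𝓝 (u w / w.im)) := by
    have hc : ContinuousAt (fun t : ℝ => u w / w.im *
      (((1 - (‖z‖ * t) ^ 2) * (1 + ‖w‖ * t) ^ 4) /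
        ((1 - ‖z‖ * t) ^ 4 * (1 - (‖w‖ * t) ^ 2)))) 0 := by
      apply ContinuousAt.mul continuousAt_const
      apply ContinuousAt.div (by fun_prop) (by fun_prop)
      simp
    have := hc.tendsto.comp tendsto_inv_atTop_zero
    simpa [Function.comp_def] using this
  apply ge_of_tendsto hlim
  filter_upwards [eventually_gt_atTop ‖z‖, eventually_gt_atTop ‖w‖] with R hzR hwR
  obtain ⟨A, hA⟩ := aux_bounds hharm hpos hcont hbdry (R := R)
  have h1 := (hA z hzR hz).2
  have h2 := (hA w hwR hw).1
  have z0 := norm_nonneg z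
  have w0 := norm_nonneg w
  have hR : 0 < R := by linarith
  have sz : 0 < R ^ 2 - ‖z‖ ^ 2 := by nlinarith
  have sw : 0 < R ^ 2 - ‖w‖ ^ 2 := by nlinarith
  have dz : 0 < R - ‖z‖ := by linarith
  have e1 : u z / z.im ≤ 2 * (R ^ 2 - ‖z‖ ^ 2) / (R - ‖z‖) ^ 4 * A := by
    rw [div_le_iff₀ hz]
    calc u z ≤ (4 * z.im * (R ^ 2 - ‖z‖ ^ 2) / (R - ‖z‖) ^ 4 * A) / 2 := by linarith
      _ = _ := by ring
  have e2 : A ≤ u w / w.im * ((R + ‖w‖) ^ 4 / (2 * (R ^ 2 - ‖w‖ ^ 2))) := by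
    have : A = (4 * w.im * (R ^ 2 - ‖w‖ ^ 2) / (R + ‖w‖) ^ 4 * A) *
        ((R + ‖w‖) ^ 4 / (4 * w.im * (R ^ 2 - ‖w‖ ^ 2))) := by
      field_simp
    rw [this]
    calc _ ≤ (2 * u w) * ((R + ‖w‖) ^ 4 / (4 * w.im * (R ^ 2 - ‖w‖ ^ 2))) := by gcongr
      _ = _ := by field_simp; ring
  have q1 : 1 - (‖z‖ * R⁻¹) ^ 2 = (R ^ 2 - ‖z‖ ^ 2) / R ^ 2 := by field_simp
  have q2 : 1 - (‖w‖ * R⁻¹) ^ 2 = (R ^ 2 - ‖w‖ ^ 2) / R ^ 2 := by field_simp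
  have q3 : 1 - ‖z‖ * R⁻¹ = (R - ‖z‖) / R := by field_simp
  have q4 : 1 + ‖w‖ * R⁻¹ = (R + ‖w‖) / R := by field_simp
  rw [q1, q2, q3, q4]
  calc u z / z.im ≤ _ := e1
    _ ≤ 2 * (R ^ 2 - ‖z‖ ^ 2) / (R - ‖z‖) ^ 4 *
      (u w / w.im * ((R + ‖w‖) ^ 4 / (2 * (R ^ 2 - ‖w‖ ^ 2)))) := by gcongr
    _ = _ := by field_simp

/-- A positive harmonic function on the upper half plane `{Im z > 0}` extending
continuously to `ℝ` with boundary value `0` is of the form `u(z) = c·Im z`, `c ≥ 0`. -/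
theorem stmt_8 (u : ℂ → ℝ)
    (hharm : HarmonicOn u {z : ℂ | 0 < z.im})
    (hpos : ∀ z : ℂ, 0 < z.im → 0 < u z)
    (hcont : ContinuousOn u {z : ℂ | 0 ≤ z.im})
    (hbdry : ∀ x : ℝ, u (x : ℂ) = 0) :
    ∃ c : ℝ, 0 ≤ c ∧ ∀ z : ℂ, 0 < z.im → u z = c * z.im := by
  refine ⟨u I / I.im, ?_, fun z hz => ?_⟩
  · have := hpos I (by simp)
    simpa using this.le
  · have h1 := aux_ratio hharm hpos hcont hbdry hz (w := I) (by simp)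
    have h2 := aux_ratio hharm hpos hcont hbdry (z := I) (by simp) hz
    rw [← le_antisymm h1 h2]
    field_simp
end

section
/- Let Ω = D(0,R) \ ⋃_{i=1}^n closure(D(pᵢ,rᵢ)) where the closed disks closure(D(pᵢ,rᵢ)) are pairwise disjoint and contained in D(0,R). Let f be C¹ on closure(Ω). Then for z ∈ Ω, f(z) = f⁺(z) + Σᵢ fᵢ⁻(z) + (1/2πi)∬_Ω (∂f/∂w̄)(w)/(w−z) dw∧dw̄, where f⁺(z) = (1/2πi)∮_{C(0,R)} f(w)/(w−z) dw is holomorphic on D(0,R) and fᵢ⁻(z) = −(1/2πi)∮_{C(pᵢ,rᵢ)} f(w)/(w−z) dw is holomorphic on ℂ \ closure(D(pᵢ,rᵢ)) and vanishes at infinity. -/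
open Complex Metric MeasureTheory

/-- The Wirtinger derivative `∂f/∂w̄ = (1/2)(∂f/∂x + i·∂f/∂y)`. -/
noncomputable def dbar (f : ℂ → ℂ) (w : ℂ) : ℂ :=
  (fderiv ℝ f w 1 + Complex.I * fderiv ℝ f w Complex.I) / 2

/-- `f⁺(z) = (1/2πi)∮_{C(0,R)} f(w)/(w−z) dw`. -/
noncomputable def fplus (R : ℝ) (f : ℂ → ℂ) (z : ℂ) : ℂ :=
  (2 * Real.pi * Complex.I)⁻¹ * ∮ w in C(0, R), f w / (w - z)

/-- `fᵢ⁻(z) = −(1/2πi)∮_{C(pᵢ,rᵢ)} f(w)/(w−z) dw`. -/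
noncomputable def fminus (p : ℂ) (r : ℝ) (f : ℂ → ℂ) (z : ℂ) : ℂ :=
  -(2 * Real.pi * Complex.I)⁻¹ * ∮ w in C(p, r), f w / (w - z)


open Set in
lemma polar_integrable (G : ℂ → ℂ) (hG : Integrable G) :
    IntegrableOn (fun q : ℝ × ℝ => q.1 • G (Complex.polarCoord.symm q)) polarCoord.target := by
  have h1 : Integrable (fun q : ℝ × ℝ => G (measurableEquivRealProd.symm q)) :=
    (Complex.volume_preserving_equiv_real_prod.symm).integrable_comp_of_integrable hG
  have h2 := (integrableOn_image_iff_integrableOn_abs_det_fderiv_smul volume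
    polarCoord.open_target.measurableSet
    (fun p _ => (hasFDerivAt_polarCoord_symm p).hasFDerivWithinAt) polarCoord.symm.injOn
    (fun q : ℝ × ℝ => G (measurableEquivRealProd.symm q))).1 h1.integrableOn
  refine h2.congr_fun ?_ polarCoord.open_target.measurableSet
  intro q hq
  have : 0 < q.1 := hq.1
  simp only [det_fderivPolarCoordSymm, abs_of_pos this, measurableEquivRealProd_symm_polarCoord_symm_apply]

open Set in
lemma polar_annulus (F : ℂ → ℂ) (c : ℂ) {a b : ℝ} (ha : 0 ≤ a)
    (hF : IntegrableOn F (ball c b \ closedBall c a)) :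
    IntegrableOn (fun q : ℝ × ℝ => q.1 • F (circleMap c q.1 q.2))
      (Ioo a b ×ˢ Ioo (-Real.pi) Real.pi) ∧
    ∫ q in (Ioo a b ×ˢ Ioo (-Real.pi) Real.pi), q.1 • F (circleMap c q.1 q.2) =
      ∫ w in (ball c b \ closedBall c a), F w := by
  set A := ball c b \ closedBall c a with hA
  have hAm : MeasurableSet A := measurableSet_ball.diff measurableSet_closedBall
  set G : ℂ → ℂ := fun w => A.indicator F (c + w) with hGdef
  have hG : Integrable G := ((integrable_indicator_iff hAm).2 hF).comp_add_left c
  have hGint : ∫ w, G w = ∫ w in A, F w := by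
    rw [← integral_indicator hAm]
    exact integral_add_left_eq_self (A.indicator F) c
  have hSm : MeasurableSet (Ioo a b ×ˢ Ioo (-Real.pi) Real.pi) :=
    measurableSet_Ioo.prod measurableSet_Ioo
  have hsub : Ioo a b ×ˢ Ioo (-Real.pi) Real.pi ⊆ polarCoord.target := by
    rintro ⟨x, y⟩ ⟨hx, hy⟩
    exact ⟨lt_of_le_of_lt ha hx.1, hy⟩
  have hsymm : ∀ q : ℝ × ℝ, c + Complex.polarCoord.symm q = circleMap c q.1 q.2 := by
    intro q
    simp [circleMap, Complex.exp_mul_I]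
  have hmem : ∀ q : ℝ × ℝ, q ∈ polarCoord.target → (circleMap c q.1 q.2 ∈ A ↔
      q ∈ Ioo a b ×ˢ Ioo (-Real.pi) Real.pi) := by
    intro q hq
    have h0 : 0 < q.1 := hq.1
    have h1 : q.2 ∈ Ioo (-Real.pi) Real.pi := hq.2
    simp only [hA, mem_sdiff, mem_ball, mem_closedBall, dist_eq_norm, circleMap_sub_center,
      norm_circleMap_zero, abs_of_pos h0, mem_prod, mem_Ioo, not_le]
    constructor
    · rintro ⟨h2, h3⟩; exact ⟨⟨h3, h2⟩, h1⟩
    · rintro ⟨⟨h2, h3⟩, _⟩; exact ⟨h3, h2⟩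
  have hEq : EqOn (fun q : ℝ × ℝ => q.1 • G (Complex.polarCoord.symm q))
      ((Ioo a b ×ˢ Ioo (-Real.pi) Real.pi).indicator
        (fun q : ℝ × ℝ => q.1 • F (circleMap c q.1 q.2))) polarCoord.target := by
    intro q hq
    simp only [hGdef, hsymm]
    by_cases h : q ∈ Ioo a b ×ˢ Ioo (-Real.pi) Real.pi
    · rw [indicator_of_mem h, indicator_of_mem ((hmem q hq).2 h)]
    · rw [indicator_of_notMem h, indicator_of_notMem (fun h' => h ((hmem q hq).1 h')), smul_zero]
  constructor
  · have := (polar_integrable G hG).congr_fun hEq polarCoord.open_target.measurableSet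
    have := this.mono_set hsub
    refine this.congr_fun ?_ hSm
    intro q hq
    exact indicator_of_mem hq _
  · rw [← hGint, ← Complex.integral_comp_polarCoord_symm G,
      setIntegral_congr_fun polarCoord.open_target.measurableSet hEq,
      setIntegral_indicator hSm, inter_eq_self_of_subset_right hsub]

lemma lin_expand (L : ℂ →L[ℝ] ℂ) (v : ℂ) : L v = v.re * L 1 + v.im * L I := by
  conv_lhs => rw [show v = v.re • (1 : ℂ) + v.im • I by simp [Complex.re_add_im]]
  rw [map_add, map_smul, map_smul]; simp

open Set in
lemma green_annulus (h : ℂ → ℂ) (c : ℂ) {a b : ℝ} (ha : 0 ≤ a) (hab : a < b)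
    (hc : ContinuousOn h (closedBall c b \ ball c a))
    (hd : ∀ w ∈ ball c b \ closedBall c a, DifferentiableAt ℝ h w)
    (hi : IntegrableOn (dbar h) (ball c b \ closedBall c a)) :
    (∮ w in C(c, b), h w) - (∮ w in C(c, a), h w) =
      2 * I * ∫ w in ball c b \ closedBall c a, dbar h w := by
  obtain ⟨hpi, hpe⟩ := polar_annulus (dbar h) c ha hi
  set E : ℝ × ℝ → ℂ := fun q => Complex.exp (q.2 * I) with hE
  set P : ℝ × ℝ → ℂ := fun q => circleMap c q.1 q.2 with hP
  have hEc : Continuous E := by fun_prop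
  have hPE : P = fun q => c + q.1 * E q := rfl
  have hPc : Continuous P := by rw [hPE]; fun_prop
  set E' : ℝ × ℝ → (ℝ × ℝ →L[ℝ] ℂ) := fun q =>
    (ContinuousLinearMap.snd ℝ ℝ ℝ).smulRight (I * E q)
  set R' : ℝ × ℝ →L[ℝ] ℂ := (ContinuousLinearMap.fst ℝ ℝ ℝ).smulRight (1 : ℂ)
  have hE' : ∀ q, HasFDerivAt E (E' q) q := by
    intro q
    have h1 : HasDerivAt (fun t : ℝ => Complex.exp (t * I)) (I * E q) q.2 := by
      have := ((hasDerivAt_id (q.2 : ℝ)).ofReal_comp.mul_const I).cexp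
      convert! this using 1
      simp [hE, mul_comm]
    have := h1.hasFDerivAt.comp q (hasFDerivAt_snd (𝕜 := ℝ) (E := ℝ) (F := ℝ))
    convert! this using 1
  have hR' : ∀ q : ℝ × ℝ, HasFDerivAt (fun q : ℝ × ℝ => (q.1 : ℂ)) R' q := by
    intro q
    have := Complex.ofRealCLM.hasFDerivAt.comp q (hasFDerivAt_fst (𝕜 := ℝ) (E := ℝ) (F := ℝ))
    convert! this using 1
    ext <;> simp [R']
  set P' : ℝ × ℝ → (ℝ × ℝ →L[ℝ] ℂ) := fun q => (q.1 : ℂ) • E' q + (E q) • R'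
  have hP' : ∀ q, HasFDerivAt P (P' q) q := by
    intro q
    rw [hPE]
    exact ((hR' q).mul (hE' q)).const_add c
  have hmaps : MapsTo P (Icc (a, -Real.pi) (b, Real.pi)) (closedBall c b \ ball c a) := by
    rintro ⟨x, y⟩ ⟨⟨h1, _⟩, ⟨h2, _⟩⟩
    simp only at h1 h2
    simp [hP, dist_eq_norm, abs_of_nonneg (ha.trans h1), h1, h2]
  have hmapsO : MapsTo P (Ioo a b ×ˢ Ioo (-Real.pi) Real.pi) (ball c b \ closedBall c a) := by
    rintro ⟨x, y⟩ ⟨⟨h1, h2⟩, _⟩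
    simp only at h1 h2
    simp [hP, dist_eq_norm, abs_of_nonneg (ha.trans h1.le), h1, h2]
  have hhP : ContinuousOn (fun q => h (P q)) (Icc (a, -Real.pi) (b, Real.pi)) :=
    hc.comp hPc.continuousOn hmaps
  set H' : ℝ × ℝ → (ℝ × ℝ →L[ℝ] ℂ) := fun q => (fderiv ℝ h (P q)).comp (P' q)
  have hH' : ∀ q ∈ Ioo a b ×ˢ Ioo (-Real.pi) Real.pi, HasFDerivAt (fun q => h (P q)) (H' q) q := by
    intro q hq
    exact (hd _ (hmapsO hq)).hasFDerivAt.comp q (hP' q)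
  have key : ∀ q : ℝ × ℝ, ((I * (q.1 * E q)) • H' q + (h (P q)) • (I • P' q)) (1, 0) +
      (-((E q) • H' q + (h (P q)) • E' q)) (0, 1) = 2 * I * (q.1 • dbar h (P q)) := by
    intro q
    simp only [H', P', E', R', dbar, _root_.add_apply, _root_.smul_apply,
      _root_.neg_apply,
      ContinuousLinearMap.comp_apply, ContinuousLinearMap.smulRight_apply,
      ContinuousLinearMap.coe_fst', ContinuousLinearMap.coe_snd', smul_eq_mul, zero_smul, one_smul,
      mul_zero, zero_add, mul_one, Complex.real_smul, add_zero]
    generalize fderiv ℝ h (P q) = L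
    have e1 : E q = Real.cos q.2 + Real.sin q.2 * I := by simp [hE, Complex.exp_mul_I]
    have e2 : ((q.1 : ℂ) * (I * E q)) = q.1 • (I * E q) := by simp
    rw [e2, map_smul, lin_expand L (E q), lin_expand L (I * E q), e1]
    have hcs : ((Real.cos q.2 : ℝ) : ℂ)^2 + ((Real.sin q.2 : ℝ) : ℂ)^2 = 1 := by
      exact_mod_cast Real.cos_sq_add_sin_sq q.2
    generalize Real.cos q.2 = x at *
    generalize Real.sin q.2 = y at *
    simp only [Complex.add_re, Complex.mul_re, Complex.ofReal_re, Complex.ofReal_im, Complex.I_re,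
      Complex.I_im, Complex.add_im, Complex.mul_im, Complex.real_smul]
    push_cast
    simp
    linear_combination (norm := skip) ((q.1 : ℂ) * (I * L 1 - L I)) * hcs
    ring_nf
    simp only [I_sq]
    ring
  have div := integral_divergence_prod_Icc_of_hasFDerivAt_off_countable_of_le
    (fun q => (I * (q.1 * E q)) * h (P q)) (fun q => -(E q * h (P q)))
    (fun q => (I * (q.1 * E q)) • H' q + (h (P q)) • (I • P' q))
    (fun q => -((E q) • H' q + (h (P q)) • E' q)) (a, -Real.pi) (b, Real.pi)
    ⟨hab.le, by linarith [Real.pi_pos]⟩ ∅ countable_empty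
    (ContinuousOn.mul (by fun_prop) hhP) (ContinuousOn.mul (by fun_prop) hhP).neg
    (by
      rintro q ⟨hq, -⟩
      exact HasFDerivAt.mul
        (((hP' q).sub_const c |>.congr_of_eventuallyEq (.of_forall fun q => by simp [hPE])).const_mul I)
        (hH' q hq))
    (by
      rintro q ⟨hq, -⟩
      exact ((hE' q).mul (hH' q hq)).neg)
    (by
      simp only [key]
      rw [Icc_prod_eq]
      refine IntegrableOn.congr_set_ae ?_
        (Measure.set_prod_ae_eq Ioo_ae_eq_Icc Ioo_ae_eq_Icc).symm
      exact hpi.const_mul _)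
  simp only [key] at div
  have hae : (Icc a b ×ˢ Icc (-Real.pi) Real.pi : Set (ℝ × ℝ)) =ᵐ[volume]
      (Ioo a b ×ˢ Ioo (-Real.pi) Real.pi : Set (ℝ × ℝ)) :=
    (Measure.set_prod_ae_eq Ioo_ae_eq_Icc Ioo_ae_eq_Icc).symm
  rw [Icc_prod_eq, setIntegral_congr_set hae, integral_const_mul, hpe] at div
  rw [div]
  have hcirc : ∀ s : ℝ, (∮ w in C(c, s), h w) =
      ∫ y in (-Real.pi)..Real.pi, (I * (s * E (s, y))) * h (P (s, y)) := by
    intro s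
    have hper : Function.Periodic (fun y : ℝ => (I * (s * E (s, y))) * h (P (s, y)))
        (2 * Real.pi) := by
      intro y
      have := periodic_circleMap c s y
      have h2 : E (s, y + 2 * Real.pi) = E (s, y) := by
        simp only [hE]; push_cast; rw [add_mul, Complex.exp_add]; simp
      simp only [hP, this, h2]
    have := hper.intervalIntegral_add_eq (-Real.pi) 0
    rw [show -Real.pi + 2 * Real.pi = Real.pi by ring, zero_add] at this
    rw [this, circleIntegral]
    congr 1
    ext y
    simp only [deriv_circleMap, hE, hP, smul_eq_mul]
    rw [show circleMap 0 s y = s * Complex.exp (y * I) by simp [circleMap]]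
    ring
  rw [hcirc, hcirc]
  have hEE : ∀ x : ℝ, E (x, Real.pi) = E (x, -Real.pi) := by
    intro x; simp [hE, Complex.exp_neg]
  have hPP : ∀ x : ℝ, P (x, Real.pi) = P (x, -Real.pi) := by
    intro x; simp only [hPE, hEE]
  simp only [hEE, hPP]
  ring

lemma dbar_congr {f g : ℂ → ℂ} {w : ℂ} (h : f =ᶠ[nhds w] g) : dbar f w = dbar g w := by
  simp only [dbar, h.fderiv_eq]

lemma dbar_zero_of {f : ℂ → ℂ} {w : ℂ} (h : f =ᶠ[nhds w] fun _ => 0) : dbar f w = 0 := by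
  rw [dbar_congr h]; simp [dbar]

lemma dbar_sub {f g : ℂ → ℂ} {w : ℂ} (hf : DifferentiableAt ℝ f w) (hg : DifferentiableAt ℝ g w) :
    dbar (fun x => f x - g x) w = dbar f w - dbar g w := by
  simp only [dbar, fderiv_fun_sub hf hg, _root_.sub_apply]; ring

lemma dbar_mul {f g : ℂ → ℂ} {w : ℂ} (hf : DifferentiableAt ℝ f w) (hg : DifferentiableAt ℝ g w) :
    dbar (fun x => f x * g x) w = f w * dbar g w + g w * dbar f w := by
  simp only [dbar, fderiv_fun_mul hf hg, _root_.add_apply, _root_.smul_apply, smul_eq_mul]; ring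

open Set in
lemma peel (Ω K : Set ℂ) (hΩ : IsOpen Ω) (hΩK : Ω ⊆ K) (p : ℂ) (r : ℝ) (hr : 0 < r)
    (hsub : closedBall p r ⊆ Ω) (g : ℂ → ℂ) (hc : ContinuousOn g (K \ ball p r))
    (hd : ∀ w ∈ Ω \ closedBall p r, DifferentiableAt ℝ g w)
    (hi : IntegrableOn (dbar g) (Ω \ closedBall p r)) :
    ∃ u : ℂ → ℂ, (∀ w, w ∉ Ω → u w = g w) ∧ ContinuousOn u K ∧
      (∀ w ∈ Ω, DifferentiableAt ℝ u w) ∧ IntegrableOn (dbar u) Ω ∧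
      2 * I * ∫ w in Ω, dbar u w =
        2 * I * (∫ w in Ω \ closedBall p r, dbar g w) + ∮ w in C(p, r), g w := by
  obtain ⟨δ, hδ, hδs⟩ := (isCompact_closedBall p r).exists_cthickening_subset_open hΩ hsub
  rw [cthickening_closedBall hδ.le hr.le] at hδs
  let χ : ContDiffBump p := ⟨r + δ / 3, r + 2 * δ / 3, by positivity, by linarith⟩
  let X : ℂ → ℂ := fun w => (χ w : ℂ)
  have hXc : ContDiff ℝ 1 X := Complex.ofRealCLM.contDiff.comp χ.contDiff
  have hXd : ∀ w, DifferentiableAt ℝ X w := fun w => (hXc.differentiable one_ne_zero) w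
  have hX1 : ∀ w ∈ closedBall p (r + δ / 3), X w = 1 := by
    intro w hw
    simp only [X, χ.one_of_mem_closedBall hw, Complex.ofReal_one]
  have hX0 : ∀ w, r + 2 * δ / 3 ≤ dist w p → X w = 0 := by
    intro w hw
    simp only [X, χ.zero_of_le_dist hw, Complex.ofReal_zero]
  have hX1n : ∀ w ∈ closedBall p r, X =ᶠ[nhds w] fun _ => 1 := by
    intro w hw
    have : w ∈ ball p (r + δ / 3) := by
      rw [mem_closedBall] at hw; rw [mem_ball]; linarith
    filter_upwards [isOpen_ball.mem_nhds this] with x hx using hX1 x (ball_subset_closedBall hx)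
  have hX0n : ∀ w, r + δ ≤ dist w p → X =ᶠ[nhds w] fun _ => 0 := by
    intro w hw
    have h1 : ∀ᶠ x in nhds w, r + 2 * δ / 3 < dist x p :=
      (continuous_id.dist continuous_const).continuousAt.eventually_const_lt
        (by simp only [id]; linarith)
    filter_upwards [h1] with x hx using hX0 x hx.le
  set A := closedBall p r
  set B := ball p (r + δ) \ A with hB
  have hAm : MeasurableSet A := measurableSet_closedBall
  have hΩm : MeasurableSet Ω := hΩ.measurableSet
  have hBΩ : B ⊆ Ω \ A := fun w hw => ⟨hδs (by
    rw [add_comm]; exact ball_subset_closedBall hw.1), hw.2⟩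
  let u : ℂ → ℂ := fun w => (1 - X w) * g w
  let v : ℂ → ℂ := fun w => X w * g w
  have hdX1 : ∀ w, DifferentiableAt ℝ (fun w => 1 - X w) w := fun w => (hXd w).const_sub 1
  have hu0 : ∀ w ∈ A, u =ᶠ[nhds w] fun _ => 0 := by
    intro w hw
    filter_upwards [hX1n w hw] with x hx
    simp [u, hx]
  have hv0 : ∀ w, r + δ ≤ dist w p → v =ᶠ[nhds w] fun _ => 0 := by
    intro w hw
    filter_upwards [hX0n w hw] with x hx
    simp [v, hx]
  have hud : ∀ w ∈ Ω, DifferentiableAt ℝ u w := by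
    intro w hw
    by_cases hwA : w ∈ A
    · exact (differentiableAt_const (0 : ℂ)).congr_of_eventuallyEq (hu0 w hwA)
    · exact (hdX1 w).mul (hd w ⟨hw, hwA⟩)
  have hvd : ∀ w ∈ Ω \ A, DifferentiableAt ℝ v w := fun w hw => (hXd w).mul (hd w hw)
  have hKsub : closedBall p (r + δ) \ ball p r ⊆ K \ ball p r := by
    intro w hw
    exact ⟨hΩK (hδs (by rw [add_comm]; exact hw.1)), hw.2⟩
  have hcomp : IsCompact (closedBall p (r + δ) \ ball p r) :=
    (isCompact_closedBall p (r + δ)).diff isOpen_ball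
  have hdXc : Continuous (dbar X) := by
    have := hXc.continuous_fderiv one_ne_zero
    unfold dbar
    fun_prop
  have hvdbar : ∀ w ∈ Ω \ A, dbar v w = X w * dbar g w + g w * dbar X w := by
    intro w hw
    exact dbar_mul (hXd w) (hd w hw)
  have hiv : IntegrableOn (dbar v) (Ω \ A) := by
    have h1 : IntegrableOn (fun w => X w * dbar g w) (Ω \ A) := by
      refine Integrable.bdd_mul (c := 1) hi hXc.continuous.aestronglyMeasurable ?_
      refine .of_forall fun w => ?_
      simp only [X, Complex.norm_real, Real.norm_eq_abs, abs_of_nonneg χ.nonneg]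
      exact χ.le_one
    have h2 : IntegrableOn (fun w => g w * dbar X w) (Ω \ A) := by
      have h3 : IntegrableOn (fun w => g w * dbar X w) (closedBall p (r + δ) \ ball p r) :=
        ((hc.mono hKsub).mul hdXc.continuousOn).integrableOn_compact hcomp
      have h4 : IntegrableOn (fun w => g w * dbar X w) B :=
        h3.mono_set (sdiff_subset_sdiff ball_subset_closedBall ball_subset_closedBall)
      refine h4.of_forall_sdiff_eq_zero (hΩm.diff hAm) ?_
      rintro w ⟨hw, hwB⟩
      have : r + δ ≤ dist w p := by
        by_contra hlt
        exact hwB ⟨by simpa using hlt, hw.2⟩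
      rw [dbar_zero_of (hX0n w this), mul_zero]
    exact (h1.add h2).congr_fun (fun w hw => (hvdbar w hw).symm) (hΩm.diff hAm)
  have hudbar : ∀ w ∈ Ω \ A, dbar u w = dbar g w - dbar v w := by
    intro w hw
    rw [← dbar_sub (hd w hw) (hvd w hw)]
    congr 1
    ext x
    simp only [u, v]; ring
  have hiu' : IntegrableOn (dbar u) (Ω \ A) :=
    (hi.sub hiv).congr_fun (fun w hw => (hudbar w hw).symm) (hΩm.diff hAm)
  have hiu0 : ∀ w ∈ Ω \ (Ω \ A), dbar u w = 0 := by
    rintro w ⟨hw, hw2⟩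
    have : w ∈ A := by by_contra h; exact hw2 ⟨hw, h⟩
    exact dbar_zero_of (hu0 w this)
  refine ⟨u, ?_, ?_, hud, hiu'.of_forall_sdiff_eq_zero hΩm hiu0, ?_⟩
  · intro w hw
    have : X w = 0 := by
      apply hX0
      by_contra hlt
      exact hw (hδs (by rw [mem_closedBall]; linarith))
    simp [u, this]
  · intro w hw
    by_cases hwA : w ∈ A
    · exact ((continuousAt_const (y := (0 : ℂ))).congr (hu0 w hwA).symm).continuousWithinAt
    · refine (hdX1 w).continuousAt.continuousWithinAt.mul ?_
      refine (hc w ⟨hw, fun h => hwA (ball_subset_closedBall h)⟩).mono_of_mem_nhdsWithin ?_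
      have : Aᶜ ∈ nhds w := isClosed_closedBall.isOpen_compl.mem_nhds hwA
      filter_upwards [self_mem_nhdsWithin, nhdsWithin_le_nhds this] with x hx hx2
      exact ⟨hx, fun h => hx2 (ball_subset_closedBall h)⟩
  · have e1 : ∫ w in Ω, dbar u w = ∫ w in Ω \ A, dbar u w :=
      setIntegral_eq_of_subset_of_forall_sdiff_eq_zero hΩm sdiff_subset hiu0
    have e2 : ∫ w in Ω \ A, dbar u w = (∫ w in Ω \ A, dbar g w) - ∫ w in Ω \ A, dbar v w := by
      rw [← integral_sub hi hiv]
      exact setIntegral_congr_fun (hΩm.diff hAm) hudbar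
    have e3 : ∫ w in Ω \ A, dbar v w = ∫ w in B, dbar v w := by
      refine setIntegral_eq_of_subset_of_forall_sdiff_eq_zero (hΩm.diff hAm) hBΩ ?_
      rintro w ⟨hw, hwB⟩
      have : r + δ ≤ dist w p := by
        by_contra hlt
        exact hwB ⟨by simpa using hlt, hw.2⟩
      exact dbar_zero_of (hv0 w this)
    have e4 := green_annulus v p hr.le (show r < r + δ by linarith)
      (hXc.continuous.continuousOn.mul (hc.mono hKsub)) (fun w hw => hvd w (hBΩ hw))
      (hiv.mono_set hBΩ)
    have e5 : (∮ w in C(p, r + δ), v w) = 0 := by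
      rw [circleIntegral.integral_congr (g := fun _ => 0) (by positivity)]
      · simp [circleIntegral]
      · intro w hw
        exact (hv0 w (by rw [mem_sphere.1 hw])).self_of_nhds
    have e6 : (∮ w in C(p, r), v w) = ∮ w in C(p, r), g w := by
      refine circleIntegral.integral_congr hr.le ?_
      intro w hw
      have := (hX1n w (sphere_subset_closedBall hw)).self_of_nhds
      simp only [v, this, one_mul]
    rw [e5, e6] at e4
    rw [e1, e2, e3, mul_sub]
    linear_combination e4

open Set in
lemma green_multi {ι : Type*} [DecidableEq ι] (R : ℝ) (hR : 0 < R) (p : ι → ℂ) (r : ι → ℝ)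
    (hr : ∀ i, 0 < r i)
    (hsub : ∀ i, closedBall (p i) (r i) ⊆ ball (0 : ℂ) R)
    (hdisj : ∀ i j, i ≠ j → Disjoint (closedBall (p i) (r i)) (closedBall (p j) (r j)))
    (s : Finset ι) : ∀ g : ℂ → ℂ,
    ContinuousOn g (closedBall 0 R \ ⋃ i ∈ s, ball (p i) (r i)) →
    (∀ w ∈ ball (0 : ℂ) R \ ⋃ i ∈ s, closedBall (p i) (r i), DifferentiableAt ℝ g w) →
    IntegrableOn (dbar g) (ball (0 : ℂ) R \ ⋃ i ∈ s, closedBall (p i) (r i)) →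
    (∮ w in C(0, R), g w) - ∑ i ∈ s, (∮ w in C(p i, r i), g w) =
      2 * I * ∫ w in ball (0 : ℂ) R \ ⋃ i ∈ s, closedBall (p i) (r i), dbar g w := by
  induction s using Finset.induction_on with
  | empty =>
    intro g hc hd hi
    simp only [Finset.notMem_empty, iUnion_of_empty, iUnion_empty, sdiff_empty] at hc hd hi
    have h := green_annulus g 0 le_rfl hR (hc.mono sdiff_subset) (fun w hw => hd w hw.1)
      (hi.mono_set sdiff_subset)
    have hae : (ball (0 : ℂ) R \ closedBall 0 0 : Set ℂ) =ᵐ[volume] ball (0 : ℂ) R := by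
      rw [closedBall_zero]
      exact sdiff_null_ae_eq_self (measure_singleton _)
    rw [setIntegral_congr_set hae, circleIntegral.integral_radius_zero, sub_zero] at h
    simpa using h
  | insert i s his ih =>
    intro g hc hd hi
    have e1 : closedBall 0 R \ ⋃ j ∈ insert i s, ball (p j) (r j) =
        (closedBall 0 R \ ⋃ j ∈ s, ball (p j) (r j)) \ ball (p i) (r i) := by
      rw [Finset.set_biUnion_insert, union_comm, Set.sdiff_sdiff]
    have e2 : ball 0 R \ ⋃ j ∈ insert i s, closedBall (p j) (r j) =
        (ball 0 R \ ⋃ j ∈ s, closedBall (p j) (r j)) \ closedBall (p i) (r i) := by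
      rw [Finset.set_biUnion_insert, union_comm, Set.sdiff_sdiff]
    rw [e1] at hc
    rw [e2] at hd hi ⊢
    have hopen : IsOpen (ball 0 R \ ⋃ j ∈ s, closedBall (p j) (r j)) :=
      isOpen_ball.sdiff (s.finite_toSet.isClosed_biUnion fun _ _ => isClosed_closedBall)
    obtain ⟨u, hu1, hu2, hu3, hu4, hu5⟩ := peel
      (ball 0 R \ ⋃ j ∈ s, closedBall (p j) (r j)) (closedBall 0 R \ ⋃ j ∈ s, ball (p j) (r j))
      hopen
      (sdiff_subset_sdiff ball_subset_closedBall (iUnion₂_mono fun _ _ => ball_subset_closedBall))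
      (p i) (r i) (hr i)
      (by
        intro w hw
        refine ⟨hsub i hw, ?_⟩
        simp only [mem_iUnion, not_exists]
        intro j hj hwj
        have hij : i ≠ j := by rintro rfl; exact his hj
        exact (Set.disjoint_left.1 (hdisj i j hij)) hw hwj) g hc hd hi
    have h := ih u hu2 hu3 hu4
    rw [hu5] at h
    rw [Finset.sum_insert his]
    have c1 : (∮ w in C(0, R), u w) = ∮ w in C(0, R), g w := by
      refine circleIntegral.integral_congr hR.le fun w hw => hu1 w fun h' => ?_
      have := h'.1
      rw [mem_sphere] at hw
      rw [mem_ball] at this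
      linarith
    have c2 : ∀ j ∈ s, (∮ w in C(p j, r j), u w) = ∮ w in C(p j, r j), g w := by
      intro j hj
      refine circleIntegral.integral_congr (hr j).le fun w hw => hu1 w fun h' => h'.2 ?_
      exact mem_biUnion (x := j) hj (sphere_subset_closedBall hw)
    rw [c1, Finset.sum_congr rfl c2] at h
    linear_combination h

open Set in
lemma cauchy_diff (f : ℂ → ℂ) (c : ℂ) (r : ℝ) (hr : 0 ≤ r) (hf : ContinuousOn f (sphere c r))
    (z : ℂ) (hz : z ∉ sphere c r) :
    DifferentiableAt ℂ (fun z => ∮ w in C(c, r), f w / (w - z)) z := by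
  obtain ⟨ε, hε, hball⟩ := Metric.isOpen_iff.1 (isClosed_sphere (x := c) (ε := r)).isOpen_compl z hz
  obtain ⟨M, hM⟩ := (isCompact_sphere c r).exists_bound_of_continuousOn hf
  have hmem : ∀ θ, circleMap c r θ ∈ sphere c r := circleMap_mem_sphere c hr
  have hfar : ∀ x ∈ ball z (ε / 2), ∀ θ, ε / 2 ≤ ‖circleMap c r θ - x‖ := by
    intro x hx θ
    by_contra hlt
    push Not at hlt
    refine hball (?_ : circleMap c r θ ∈ ball z ε) (hmem θ)
    rw [mem_ball] at hx ⊢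
    have := dist_triangle (circleMap c r θ) x z
    rw [dist_eq_norm (circleMap c r θ) x] at this
    linarith
  have hne : ∀ x ∈ ball z (ε / 2), ∀ θ, circleMap c r θ - x ≠ 0 := by
    intro x hx θ h0
    have := hfar x hx θ
    rw [h0, norm_zero] at this
    linarith
  have hfc : Continuous fun θ => f (circleMap c r θ) :=
    hf.comp_continuous (continuous_circleMap c r) hmem
  have hdc : Continuous (deriv (circleMap c r)) := by
    simp only [funext (deriv_circleMap c r)]
    fun_prop
  have hcm := continuous_circleMap c r
  have hz' : z ∈ ball z (ε / 2) := mem_ball_self (by positivity)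
  have hFc : ∀ x ∈ ball z (ε / 2), Continuous
      (fun θ => deriv (circleMap c r) θ • (f (circleMap c r θ) / (circleMap c r θ - x))) := by
    intro x hx
    exact hdc.smul (hfc.div (hcm.sub continuous_const) (hne x hx))
  have hF'c : Continuous (fun θ => deriv (circleMap c r) θ •
      (f (circleMap c r θ) / (circleMap c r θ - z) ^ 2)) :=
    hdc.smul (hfc.div ((hcm.sub continuous_const).pow 2) (fun θ => pow_ne_zero 2 (hne z hz' θ)))
  have := intervalIntegral.hasDerivAt_integral_of_dominated_loc_of_deriv_le
    (μ := volume) (a := 0) (b := 2 * Real.pi) (𝕜 := ℂ) (x₀ := z) (s := ball z (ε / 2))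
    (F := fun x θ => deriv (circleMap c r) θ • (f (circleMap c r θ) / (circleMap c r θ - x)))
    (F' := fun x θ => deriv (circleMap c r) θ •
      (f (circleMap c r θ) / (circleMap c r θ - x) ^ 2))
    (bound := fun _ => r * (M / (ε / 2) ^ 2))
    (ball_mem_nhds z (by positivity))
    (by
      filter_upwards [ball_mem_nhds z (show 0 < ε / 2 by positivity)] with x hx
      exact (hFc x hx).aestronglyMeasurable)
    ((hFc z hz').intervalIntegrable _ _) hF'c.aestronglyMeasurable
    (by
      refine .of_forall fun θ _ x hx => ?_
      rw [norm_smul, norm_div, norm_pow]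
      have h1 : ‖deriv (circleMap c r) θ‖ = r := by simp [deriv_circleMap, abs_of_nonneg hr]
      rw [h1]
      have h2 := hfar x hx θ
      have h3 := hM _ (hmem θ)
      have h4 : 0 ≤ M := (norm_nonneg _).trans h3
      gcongr)
    intervalIntegrable_const
    (by
      refine .of_forall fun θ _ x hx => ?_
      have h1 : HasDerivAt (fun x => circleMap c r θ - x) (-1) x := (hasDerivAt_id x).const_sub _
      have h2 := ((h1.inv (hne x hx θ)).const_mul (f (circleMap c r θ))).const_smul
        (deriv (circleMap c r) θ)
      convert! h2 using 1
      simp [div_eq_mul_inv])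
  exact this.2.differentiableAt

open Set Filter in
lemma cauchy_tendsto (f : ℂ → ℂ) (c : ℂ) (r : ℝ) (hr : 0 ≤ r) (hf : ContinuousOn f (sphere c r)) :
    Tendsto (fun z => ∮ w in C(c, r), f w / (w - z)) (Bornology.cobounded ℂ) (nhds 0) := by
  obtain ⟨M, hM⟩ := (isCompact_sphere c r).exists_bound_of_continuousOn hf
  have hM0 : 0 ≤ M := (norm_nonneg _).trans (hM _ (circleMap_mem_sphere c hr 0))
  have hnorm : Tendsto (fun z : ℂ => ‖z‖ + (- ‖c‖ - r)) (Bornology.cobounded ℂ) atTop :=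
    tendsto_atTop_add_const_right _ _ tendsto_norm_cobounded_atTop
  have hlim : Tendsto (fun z : ℂ => 2 * Real.pi * r * (M / (‖z‖ + (- ‖c‖ - r))))
      (Bornology.cobounded ℂ) (nhds 0) := by
    simpa using (hnorm.const_div_atTop M).const_mul (2 * Real.pi * r)
  refine squeeze_zero_norm' ?_ hlim
  filter_upwards [hnorm.eventually_gt_atTop 0] with z hz
  refine circleIntegral.norm_integral_le_of_norm_le_const hr fun w hw => ?_
  rw [norm_div]
  have h1 := hM w hw
  have h2 : ‖z‖ + (- ‖c‖ - r) ≤ ‖w - z‖ := by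
    have h3 : ‖w - c‖ = r := by rw [← dist_eq_norm]; exact hw
    have h4 := norm_sub_norm_le z w
    have h5 := norm_sub_norm_le w c
    rw [norm_sub_rev z w] at h4
    linarith
  gcongr

open Set Filter Topology in
lemma fderiv_bdd (f : ℂ → ℂ) (Ω : Set ℂ) (ho : IsOpen Ω) (hb : Bornology.IsBounded Ω)
    (hf : ContDiffOn ℝ 1 f (closure Ω)) : ∃ M, ∀ w ∈ Ω, ‖fderiv ℝ f w‖ ≤ M := by
  have hK : IsCompact (closure Ω) := hb.isCompact_closure
  have key : ∃ M, ∀ w ∈ closure Ω, w ∈ Ω → ‖fderiv ℝ f w‖ ≤ M := by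
    refine hK.induction_on (p := fun s => ∃ M, ∀ w ∈ s, w ∈ Ω → ‖fderiv ℝ f w‖ ≤ M) ?_ ?_ ?_ ?_
    · exact ⟨0, fun w hw => hw.elim⟩
    · rintro s t hst ⟨M, hM⟩
      exact ⟨M, fun w hw => hM w (hst hw)⟩
    · rintro s t ⟨M, hM⟩ ⟨N, hN⟩
      refine ⟨max M N, fun w hw hwo => ?_⟩
      rcases hw with hw | hw
      · exact (hM w hw hwo).trans (le_max_left _ _)
      · exact (hN w hw hwo).trans (le_max_right _ _)
    · intro x hx
      have h1 : ContDiffWithinAt ℝ (0 + 1) f (closure Ω) x := by simpa using hf x hx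
      obtain ⟨u, hu, -, f', hf', hc⟩ :=
        (contDiffWithinAt_succ_iff_hasFDerivWithinAt (by simp)).1 h1
      rw [insert_eq_of_mem hx] at hu
      have hxu : x ∈ u := mem_of_mem_nhdsWithin hx hu
      have hcont : ContinuousWithinAt f' u x := hc.continuousWithinAt
      have hev : ∀ᶠ y in 𝓝[u] x, ‖f' y‖ < ‖f' x‖ + 1 :=
        hcont.norm.eventually_lt_const (by linarith)
      obtain ⟨V, hVo, hxV, hV⟩ := mem_nhdsWithin.1 hu
      obtain ⟨W, hWo, hxW, hW⟩ := mem_nhdsWithin.1 hev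
      refine ⟨V ∩ W ∩ closure Ω, ?_, ‖f' x‖ + 1, ?_⟩
      · rw [inter_comm]
        exact inter_mem_nhdsWithin _ ((hVo.inter hWo).mem_nhds ⟨hxV, hxW⟩)
      · rintro y ⟨⟨hyV, hyW⟩, hyc⟩ hyo
        have hyu : y ∈ u := hV ⟨hyV, hyc⟩
        have hun : u ∈ 𝓝 y := by
          filter_upwards [(hVo.inter ho).mem_nhds ⟨hyV, hyo⟩] with a ha
          exact hV ⟨ha.1, subset_closure ha.2⟩
        rw [((hf' y hyu).hasFDerivAt hun).fderiv]
        exact (hW ⟨hyW, hyu⟩ : ‖f' y‖ < _).le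
  obtain ⟨M, hM⟩ := key
  exact ⟨M, fun w hw => hM w (subset_closure hw) hw⟩

lemma dbar_norm_le (f : ℂ → ℂ) (w : ℂ) : ‖dbar f w‖ ≤ ‖fderiv ℝ f w‖ := by
  unfold dbar
  have h1 : ‖fderiv ℝ f w 1‖ ≤ ‖fderiv ℝ f w‖ := by
    simpa using (fderiv ℝ f w).le_opNorm 1
  have h2 : ‖fderiv ℝ f w I‖ ≤ ‖fderiv ℝ f w‖ := by
    simpa using (fderiv ℝ f w).le_opNorm I
  have h3 := norm_add_le (fderiv ℝ f w 1) (I * fderiv ℝ f w I)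
  rw [norm_mul, norm_I, one_mul] at h3
  rw [norm_div]
  simp only [RCLike.norm_ofNat]
  linarith

open Set in
lemma inv_integrable (z : ℂ) (s : Set ℂ) (hb : Bornology.IsBounded s) :
    IntegrableOn (fun w : ℂ => (w - z)⁻¹) s := by
  have h0 : LocallyIntegrable (fun w : ℂ => w⁻¹) := by
    refine locallyIntegrable_of_norm_le_rpow (α := 1) (C := 1) ?_ ?_ ?_ ?_
    all_goals first | (simp; done) | skip
    · refine Filter.Eventually.of_forall fun x => ?_
      simp [Real.rpow_neg_one]
    · exact measurable_inv.aestronglyMeasurable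
  obtain ⟨ρ, hρ⟩ := hb.subset_closedBall z
  refine IntegrableOn.mono_set ?_ hρ
  have h1 : IntegrableOn (fun w : ℂ => w⁻¹) (closedBall 0 ρ) :=
    h0.integrableOn_isCompact (isCompact_closedBall _ _)
  have h2 := (measurePreserving_sub_right (volume : Measure ℂ) z).integrableOn_comp_preimage
    (MeasurableEquiv.subRight z).measurableEmbedding (f := fun w : ℂ => w⁻¹) (s := closedBall 0 ρ)
  have h3 := h2.2 h1
  refine h3.mono_set ?_
  intro x hx
  simpa [dist_eq_norm] using hx

open Set in
lemma dbar_cont (f : ℂ → ℂ) (Ω : Set ℂ) (ho : IsOpen Ω) (hf : ContDiffOn ℝ 1 f Ω) :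
    ContinuousOn (dbar f) Ω := by
  have h := hf.continuousOn_fderiv_of_isOpen ho (by norm_num)
  unfold dbar
  exact ((h.clm_apply continuousOn_const).add
    (continuousOn_const.mul (h.clm_apply continuousOn_const))).div_const _

open Set in
lemma dbar_div_integrable (f : ℂ → ℂ) (Ω : Set ℂ) (ho : IsOpen Ω) (hb : Bornology.IsBounded Ω)
    (hf : ContDiffOn ℝ 1 f (closure Ω)) (z : ℂ) :
    IntegrableOn (fun w => dbar f w / (w - z)) Ω := by
  obtain ⟨M, hM⟩ := fderiv_bdd f Ω ho hb hf
  have hm : AEStronglyMeasurable (dbar f) (volume.restrict Ω) :=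
    (dbar_cont f Ω ho (hf.mono subset_closure)).aestronglyMeasurable ho.measurableSet
  simp only [div_eq_mul_inv]
  refine Integrable.bdd_mul (c := M) (inv_integrable z Ω hb) hm ?_
  filter_upwards [ae_restrict_mem ho.measurableSet] with w hw
  exact (dbar_norm_le f w).trans (hM w hw)

lemma dbar_div (f : ℂ → ℂ) (z w : ℂ) (hw : w ≠ z) (hf : DifferentiableAt ℝ f w) :
    DifferentiableAt ℝ (fun x => f x / (x - z)) w ∧
    dbar (fun x => f x / (x - z)) w = dbar f w / (w - z) := by
  have hc : DifferentiableAt ℂ (fun x : ℂ => (x - z)⁻¹) w :=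
    (differentiableAt_id.sub_const z).inv (sub_ne_zero.2 hw)
  have hg : DifferentiableAt ℝ (fun x : ℂ => (x - z)⁻¹) w := hc.restrictScalars ℝ
  have h0 : dbar (fun x : ℂ => (x - z)⁻¹) w = 0 := by
    unfold dbar
    rw [hc.fderiv_restrictScalars ℝ]
    have : fderiv ℂ (fun x : ℂ => (x - z)⁻¹) w I = I * fderiv ℂ (fun x : ℂ => (x - z)⁻¹) w 1 := by
      rw [← smul_eq_mul, ← map_smul]; simp
    simp only [ContinuousLinearMap.coe_restrictScalars']
    rw [this, ← mul_assoc, I_mul_I]; simp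
  simp only [div_eq_mul_inv]
  refine ⟨hf.mul hg, ?_⟩
  rw [dbar_mul hf hg, h0, mul_zero, zero_add, mul_comm]

open Set in
lemma sub_closure {n : ℕ} (R : ℝ) (hR : 0 < R) (p : Fin n → ℂ) (r : Fin n → ℝ)
    (hr : ∀ i, 0 < r i)
    (hsub : ∀ i, closedBall (p i) (r i) ⊆ ball (0 : ℂ) R)
    (hdisj : ∀ i j, i ≠ j → Disjoint (closedBall (p i) (r i)) (closedBall (p j) (r j))) :
    closedBall 0 R \ ⋃ i, ball (p i) (r i) ⊆
      closure (ball (0 : ℂ) R \ ⋃ i, closedBall (p i) (r i)) := by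
  rintro w ⟨hw, hwn⟩
  by_cases h : ∃ i, w ∈ closedBall (p i) (r i)
  · obtain ⟨i, hi⟩ := h
    have hcl : IsClosed (⋃ j ∈ {j | j ≠ i}, closedBall (p j) (r j)) :=
      (toFinite _).isClosed_biUnion fun _ _ => isClosed_closedBall
    have hU : IsOpen (ball (0 : ℂ) R \ ⋃ j ∈ {j | j ≠ i}, closedBall (p j) (r j)) :=
      isOpen_ball.sdiff hcl
    have hwU : w ∈ ball (0 : ℂ) R \ ⋃ j ∈ {j | j ≠ i}, closedBall (p j) (r j) := by
      refine ⟨hsub i hi, ?_⟩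
      simp only [mem_iUnion, not_exists]
      intro j hj hwj
      exact disjoint_left.1 (hdisj j i hj) hwj hi
    have hwc : w ∈ closure (closedBall (p i) (r i))ᶜ := by
      rw [closure_compl, interior_closedBall _ (hr i).ne']
      exact fun h => hwn (mem_iUnion.2 ⟨i, h⟩)
    refine closure_mono ?_ (hU.inter_closure ⟨hwU, hwc⟩)
    rintro x ⟨⟨hx1, hx2⟩, hx3⟩
    refine ⟨hx1, ?_⟩
    simp only [mem_iUnion, not_exists] at hx2 ⊢
    intro j hj
    by_cases hji : j = i
    · subst hji; exact hx3 hj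
    · exact hx2 j hji hj
  · have hcl : IsClosed (⋃ j, closedBall (p j) (r j)) :=
      isClosed_iUnion_of_finite fun _ => isClosed_closedBall
    have hwU : w ∈ (⋃ j, closedBall (p j) (r j))ᶜ := by simpa using h
    have hwc : w ∈ closure (ball (0:ℂ) R) := by rwa [closure_ball _ hR.ne']
    refine closure_mono ?_ (hcl.isOpen_compl.inter_closure ⟨hwU, hwc⟩)
    rintro x ⟨h1, h2⟩
    exact ⟨h2, h1⟩

open Set Filter Topology in
lemma small_circle (f : ℂ → ℂ) (z : ℂ) (d : ℕ → ℝ) (hd : ∀ k, 0 < d k)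
    (hd0 : Tendsto d atTop (𝓝 0)) (D : ℝ) (hdD : ∀ k, d k ≤ D)
    (hf : ContinuousOn f (closedBall z D)) :
    Tendsto (fun k => ∮ w in C(z, d k), f w / (w - z)) atTop (𝓝 (2 * Real.pi * I * f z)) := by
  have he : ∀ k, (∮ w in C(z, d k), f w / (w - z)) =
      ∫ θ in (0:ℝ)..2 * Real.pi, I * f (circleMap z (d k) θ) := by
    intro k
    unfold circleIntegral
    congr 1
    ext θ
    have : circleMap 0 (d k) θ ≠ 0 := by simp [(hd k).ne']
    rw [deriv_circleMap, smul_eq_mul]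
    simp only [circleMap_sub_center]
    field_simp
  have hl : 2 * Real.pi * I * f z = ∫ θ in (0:ℝ)..2 * Real.pi, I * f z := by
    rw [intervalIntegral.integral_const]; simp [mul_assoc]
  have hmem : ∀ k θ, circleMap z (d k) θ ∈ closedBall z D := fun k θ =>
    closedBall_subset_closedBall (hdD k) (circleMap_mem_closedBall z (hd k).le θ)
  obtain ⟨M, hM⟩ := (isCompact_closedBall z D).exists_bound_of_continuousOn hf
  simp only [he]
  rw [hl]
  refine intervalIntegral.tendsto_integral_filter_of_dominated_convergence (fun _ => M) ?_ ?_ ?_ ?_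
  · refine Eventually.of_forall fun k => Continuous.aestronglyMeasurable ?_
    exact continuous_const.mul (hf.comp_continuous (continuous_circleMap z (d k)) (hmem k))
  · refine Eventually.of_forall fun k => Eventually.of_forall fun θ _ => ?_
    rw [norm_mul, norm_I, one_mul]
    exact hM _ (hmem k θ)
  · simp
  · refine Eventually.of_forall fun θ _ => ?_
    have hD : 0 < D := (hd 0).trans_le (hdD 0)
    have hfz : ContinuousAt f z := hf.continuousAt (closedBall_mem_nhds z hD)
    refine Tendsto.const_mul _ (hfz.tendsto.comp ?_)
    have : Tendsto (fun k => z + (d k : ℂ) * exp (θ * I)) atTop (𝓝 (z + ((0:ℝ):ℂ) * exp (θ * I))) :=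
      (((continuous_ofReal.tendsto 0).comp hd0).mul_const _).const_add _
    simpa [circleMap] using this

open Set in
lemma pompeiu_delta {n : ℕ} (R : ℝ) (hR : 0 < R) (p : Fin n → ℂ) (r : Fin n → ℝ)
    (hr : ∀ i, 0 < r i)
    (hsub : ∀ i, closedBall (p i) (r i) ⊆ ball (0 : ℂ) R)
    (hdisj : ∀ i j, i ≠ j → Disjoint (closedBall (p i) (r i)) (closedBall (p j) (r j)))
    (f : ℂ → ℂ) (Ω : Set ℂ) (hΩ : Ω = ball (0 : ℂ) R \ ⋃ i, closedBall (p i) (r i))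
    (ho : IsOpen Ω)
    (hf : ContDiffOn ℝ 1 f (closure Ω)) (z : ℂ) (d : ℝ) (hd : 0 < d)
    (hz : closedBall z d ⊆ Ω) :
    (∮ w in C(0, R), f w / (w - z)) - ((∮ w in C(z, d), f w / (w - z)) +
      ∑ i, ∮ w in C(p i, r i), f w / (w - z)) =
    2 * I * ∫ w in Ω \ closedBall z d, dbar f w / (w - z) := by
  have hb : Bornology.IsBounded Ω := by rw [hΩ]; exact isBounded_ball.subset sdiff_subset
  let P : Option (Fin n) → ℂ := fun o => o.elim z p
  let Q : Option (Fin n) → ℝ := fun o => o.elim d r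
  have hdj : ∀ i, Disjoint (closedBall z d) (closedBall (p i) (r i)) := by
    intro i
    rw [disjoint_left]
    intro a ha hai
    have := hz ha
    rw [hΩ] at this
    exact this.2 (mem_iUnion.2 ⟨i, hai⟩)
  have e1 : ball (0:ℂ) R \ ⋃ o ∈ (Finset.univ : Finset (Option (Fin n))), closedBall (P o) (Q o)
      = Ω \ closedBall z d := by
    ext x
    simp only [hΩ, P, Q, mem_sdiff, Finset.mem_univ, iUnion_true, mem_iUnion, Option.exists,
      Option.elim_none, Option.elim_some, not_or]
    tauto
  have e2 : closedBall (0:ℂ) R \ ⋃ o ∈ (Finset.univ : Finset (Option (Fin n))), ball (P o) (Q o)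
      = (closedBall (0:ℂ) R \ ⋃ i, ball (p i) (r i)) \ ball z d := by
    ext x
    simp only [P, Q, mem_sdiff, Finset.mem_univ, iUnion_true, mem_iUnion, Option.exists,
      Option.elim_none, Option.elim_some, not_or]
    tauto
  have hne : ∀ w ∈ Ω \ closedBall z d, w ≠ z := by
    rintro w ⟨-, hw⟩ rfl
    exact hw (mem_closedBall_self hd.le)
  have hdf : ∀ w ∈ Ω, DifferentiableAt ℝ f w := fun w hw =>
    ((hf.mono subset_closure).differentiableOn (by norm_num)).differentiableAt (ho.mem_nhds hw)
  have hmeas : MeasurableSet (Ω \ closedBall z d) := ho.measurableSet.diff measurableSet_closedBall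
  have hdb : ∀ w ∈ Ω \ closedBall z d,
      dbar (fun x => f x / (x - z)) w = dbar f w / (w - z) := fun w hw =>
    (dbar_div f z w (hne w hw) (hdf w hw.1)).2
  have G := green_multi R hR P Q ?_ ?_ ?_ Finset.univ (fun x => f x / (x - z)) ?_ ?_ ?_
  · rw [e1, Fintype.sum_option] at G
    rw [setIntegral_congr_fun hmeas hdb] at G
    exact G
  · rintro (_ | i)
    · exact hd
    · exact hr i
  · rintro (_ | i)
    · rw [hΩ] at hz
      exact hz.trans sdiff_subset
    · exact hsub i
  · rintro (_ | i) (_ | j) hij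
    · exact absurd rfl hij
    · exact hdj j
    · exact (hdj i).symm
    · exact hdisj i j (fun h => hij (by rw [h]))
  · rw [e2]
    refine ContinuousOn.div (hf.continuousOn.mono ?_) (by fun_prop) ?_
    · rw [hΩ]
      exact sdiff_subset.trans (sub_closure R hR p r hr hsub hdisj)
    · rintro x ⟨-, hx⟩ h0
      rw [sub_eq_zero.1 h0] at hx
      exact hx (mem_ball_self hd)
  · rw [e1]
    exact fun w hw => (dbar_div f z w (hne w hw) (hdf w hw.1)).1
  · rw [e1]
    refine IntegrableOn.congr_fun ?_ (fun w hw => (hdb w hw).symm) hmeas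
    exact (dbar_div_integrable f Ω ho hb hf z).mono_set sdiff_subset

open Set Filter Topology in
lemma pompeiu {n : ℕ} (R : ℝ) (hR : 0 < R) (p : Fin n → ℂ) (r : Fin n → ℝ)
    (hr : ∀ i, 0 < r i)
    (hsub : ∀ i, closedBall (p i) (r i) ⊆ ball (0 : ℂ) R)
    (hdisj : ∀ i j, i ≠ j → Disjoint (closedBall (p i) (r i)) (closedBall (p j) (r j)))
    (f : ℂ → ℂ) (Ω : Set ℂ) (hΩ : Ω = ball (0 : ℂ) R \ ⋃ i, closedBall (p i) (r i))
    (hf : ContDiffOn ℝ 1 f (closure Ω)) (z : ℂ) (hz : z ∈ Ω) :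
    (∮ w in C(0, R), f w / (w - z)) - (2 * Real.pi * I * f z +
      ∑ i, ∮ w in C(p i, r i), f w / (w - z)) =
    2 * I * ∫ w in Ω, dbar f w / (w - z) := by
  have ho : IsOpen Ω := by
    rw [hΩ]
    exact isOpen_ball.sdiff (isClosed_iUnion_of_finite fun _ => isClosed_closedBall)
  have hb : Bornology.IsBounded Ω := by rw [hΩ]; exact isBounded_ball.subset sdiff_subset
  obtain ⟨D, hD, hDΩ⟩ := Metric.nhds_basis_closedBall.mem_iff.1 (ho.mem_nhds hz)
  let d : ℕ → ℝ := fun k => D / ((k : ℝ) + 1)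
  have hd : ∀ k, 0 < d k := fun k => by positivity
  have hdD : ∀ k, d k ≤ D := fun k =>
    div_le_self hD.le (by have : (0:ℝ) ≤ k := k.cast_nonneg; linarith)
  have hanti : Antitone d := by
    intro k l hkl
    have : (k : ℝ) ≤ l := by exact_mod_cast hkl
    simp only [d]
    gcongr
  have hd0 : Tendsto d atTop (𝓝 0) := by
    have := tendsto_one_div_add_atTop_nhds_zero_nat (𝕜 := ℝ)
    simpa [d, div_eq_mul_inv] using this.const_mul D
  have hk : ∀ k, closedBall z (d k) ⊆ Ω := fun k =>
    (closedBall_subset_closedBall (hdD k)).trans hDΩ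
  have L1 := small_circle f z d hd hd0 D hdD (hf.continuousOn.mono (hDΩ.trans subset_closure))
  have hU : ⋃ k, Ω \ closedBall z (d k) = Ω \ {z} := by
    ext x
    simp only [mem_iUnion, Set.mem_sdiff, mem_singleton_iff, exists_and_left]
    refine and_congr_right fun _ => ⟨?_, ?_⟩
    · rintro ⟨k, hk⟩ rfl
      exact hk (mem_closedBall_self (hd k).le)
    · intro hx
      obtain ⟨k, hk⟩ := (hd0.eventually_lt_const (dist_pos.2 hx)).exists
      exact ⟨k, fun h => absurd (mem_closedBall.1 h) (not_le.2 hk)⟩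
  have hint := dbar_div_integrable f Ω ho hb hf z
  have L2 : Tendsto (fun k => ∫ w in Ω \ closedBall z (d k), dbar f w / (w - z)) atTop
      (𝓝 (∫ w in Ω, dbar f w / (w - z))) := by
    have := tendsto_setIntegral_of_monotone (μ := volume) (f := fun w => dbar f w / (w - z))
      (s := fun k => Ω \ closedBall z (d k))
      (fun k => ho.measurableSet.diff measurableSet_closedBall)
      (fun k l hkl => sdiff_subset_sdiff_right (closedBall_subset_closedBall (hanti hkl)))
      (by rw [hU]; exact hint.mono_set sdiff_subset)
    rw [hU] at this
    rwa [setIntegral_congr_set (sdiff_null_ae_eq_self (measure_singleton z))] at this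
  have hE := fun k => pompeiu_delta R hR p r hr hsub hdisj f Ω hΩ ho hf z (d k) (hd k) (hk k)
  refine tendsto_nhds_unique ((L1.add_const _).const_sub _) ?_
  simp only [hE]
  exact L2.const_mul _

/-- Cauchy–Pompeiu representation on the multiply connected domain
`Ω = D(0,R) \ ⋃ᵢ closure(D(pᵢ,rᵢ))`: for `f` of class `C¹` on `closure Ω` and `z ∈ Ω`,
`f(z) = f⁺(z) + Σᵢ fᵢ⁻(z) + (1/2πi)∬_Ω (∂f/∂w̄)(w)/(w−z) dw∧dw̄`
(with `dw∧dw̄ = −2i·dA`); moreover `f⁺` is holomorphic on `D(0,R)` and each `fᵢ⁻` is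
holomorphic outside `closure(D(pᵢ,rᵢ))` and vanishes at infinity. -/
theorem stmt_12 (R : ℝ) (hR : 0 < R) (n : ℕ) (p : Fin n → ℂ) (r : Fin n → ℝ)
    (hr : ∀ i, 0 < r i)
    (hsub : ∀ i, closedBall (p i) (r i) ⊆ ball (0 : ℂ) R)
    (hdisj : ∀ i j, i ≠ j → Disjoint (closedBall (p i) (r i)) (closedBall (p j) (r j)))
    (f : ℂ → ℂ)
    (hf : ContDiffOn ℝ 1 f (closure (ball (0 : ℂ) R \ ⋃ i, closedBall (p i) (r i)))) :
    (∀ z ∈ ball (0 : ℂ) R \ ⋃ i, closedBall (p i) (r i),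
      f z = fplus R f z + (∑ i, fminus (p i) (r i) f z) +
        (2 * Real.pi * Complex.I)⁻¹ *
          ((-2 * Complex.I) *
            ∫ w in (ball (0 : ℂ) R \ ⋃ i, closedBall (p i) (r i)),
              dbar f w / (w - z))) ∧
    DifferentiableOn ℂ (fplus R f) (ball (0 : ℂ) R) ∧
    (∀ i, DifferentiableOn ℂ (fminus (p i) (r i) f) (closedBall (p i) (r i))ᶜ) ∧
    (∀ i, Filter.Tendsto (fminus (p i) (r i) f) (Bornology.cobounded ℂ) (nhds 0)) := by
  have hsc := sub_closure R hR p r hr hsub hdisj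
  have hc0 : ContinuousOn f (sphere 0 R) := by
    refine hf.continuousOn.mono (Set.Subset.trans ?_ hsc)
    intro x hx
    refine ⟨sphere_subset_closedBall hx, fun h => ?_⟩
    obtain ⟨i, hi⟩ := Set.mem_iUnion.1 h
    have h1 := mem_ball.1 (hsub i (ball_subset_closedBall hi))
    rw [mem_sphere.1 hx] at h1
    exact lt_irrefl _ h1
  have hci : ∀ i, ContinuousOn f (sphere (p i) (r i)) := by
    intro i
    refine hf.continuousOn.mono (Set.Subset.trans ?_ hsc)
    intro x hx
    have hx' := sphere_subset_closedBall hx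
    refine ⟨ball_subset_closedBall (hsub i hx'), fun h => ?_⟩
    obtain ⟨j, hj⟩ := Set.mem_iUnion.1 h
    by_cases hji : j = i
    · subst hji
      have h1 := mem_ball.1 hj
      rw [mem_sphere.1 hx] at h1
      exact lt_irrefl _ h1
    · exact Set.disjoint_left.1 (hdisj j i hji) (ball_subset_closedBall hj) hx'
  refine ⟨?_, ?_, ?_, ?_⟩
  · intro z hz
    have h := pompeiu R hR p r hr hsub hdisj f _ rfl hf z hz
    have hpi : (2 * Real.pi * Complex.I : ℂ) ≠ 0 := two_pi_I_ne_zero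
    simp only [fplus, fminus]
    rw [← Finset.mul_sum]
    have h2 : f z = (2 * Real.pi * Complex.I)⁻¹ * (2 * Real.pi * Complex.I * f z) := by
      rw [inv_mul_cancel_left₀ hpi]
    rw [h2]
    linear_combination (-(2 * Real.pi * Complex.I : ℂ)⁻¹) * h
  · intro z hz
    refine DifferentiableAt.differentiableWithinAt ?_
    refine (cauchy_diff f 0 R hR.le hc0 z ?_).const_mul _
    intro h
    rw [mem_ball, mem_sphere.1 h] at hz
    exact lt_irrefl _ hz
  · intro i z hz
    refine DifferentiableAt.differentiableWithinAt ?_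
    refine (cauchy_diff f (p i) (r i) (hr i).le (hci i) z ?_).const_mul _
    exact fun h => hz (sphere_subset_closedBall h)
  · intro i
    have h := (cauchy_tendsto f (p i) (r i) (hr i).le (hci i)).const_mul
      (-(2 * Real.pi * Complex.I)⁻¹)
    rw [mul_zero] at h
    exact h
end
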